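/- Let J be a real random variable with P(J = √6) = P(J = −√6) = 1/30, P(J = 1) = P(J = −1) = 3/10, and P(J = 0) = 1/3. Then the first seven moments of J coincide with those of the standard normal distribution N(0,1): E[J] = E[J³] = E[J⁵] = E[J⁷] = 0, E[J²] = 1, E[J⁴] = 3, and E[J⁶] = 15. -/

import Mathlib

open MeasureTheory

/-- If a random variable puts total mass one on a finite set `s`, then the expectation of
`f ∘ X` is the corresponding finite weighted sum. -/
theorem integral_comp_eq_sum_of_sum_measureReal_eq_one
    {Ω E : Type*} [MeasurableSpace Ω] [MeasurableSpace E] [MeasurableSingletonClass E]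
    {P : Measure Ω} [IsProbabilityMeasure P] {X : Ω → E} (hX : Measurable X)
    {s : Finset E} (hs : ∑ x ∈ s, P.real (X ⁻¹' {x}) = 1) {f : E → ℝ} (hf : Measurable f) :
    ∫ ω, f (X ω) ∂P = ∑ x ∈ s, P.real (X ⁻¹' {x}) * f x := by
  have hmap : ∀ x, (P.map X).real {x} = P.real (X ⁻¹' {x}) := fun x =>
    map_measureReal_apply hX (measurableSet_singleton x)
  have : IsProbabilityMeasure (P.map X) := Measure.isProbabilityMeasure_map hX.aemeasurable
  have hone : (P.map X).real (s : Set E) = 1 := by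
    rw [← sum_measureReal_singleton, Finset.sum_congr rfl fun x _ => hmap x, hs]
  have hae : ∀ᵐ x ∂P.map X, x ∈ (s : Set E) := by
    rw [ae_iff]
    refine (prob_compl_eq_zero_iff s.measurableSet).2 ?_
    simpa [measureReal_def, ENNReal.toReal_eq_one_iff] using hone
  rw [← integral_map hX.aemeasurable hf.aestronglyMeasurable,
    ← Measure.restrict_eq_self_of_ae_mem hae, setIntegral_finset s IntegrableOn.finset]
  simp [hmap]

/-- The discrete random variable taking values `±√6` with probability `1/30` each,
`±1` with probability `3/10` each, and `0` with probability `1/3` has the same first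
seven moments as `N(0,1)`: `E[J] = E[J³] = E[J⁵] = E[J⁷] = 0`, `E[J²] = 1`,
`E[J⁴] = 3`, `E[J⁶] = 15`. -/
theorem discrete_five_point_moments_match_gaussian
    {Ω : Type*} [MeasurableSpace Ω] (P : Measure Ω) [IsProbabilityMeasure P]
    (J : Ω → ℝ) (hJ : Measurable J)
    (h1 : P {ω | J ω = Real.sqrt 6} = 1 / 30)
    (h2 : P {ω | J ω = -Real.sqrt 6} = 1 / 30)
    (h3 : P {ω | J ω = 1} = 3 / 10)
    (h4 : P {ω | J ω = -1} = 3 / 10)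
    (h5 : P {ω | J ω = 0} = 1 / 3) :
    (∫ ω, J ω ∂P = 0) ∧ (∫ ω, (J ω) ^ 2 ∂P = 1) ∧ (∫ ω, (J ω) ^ 3 ∂P = 0) ∧
      (∫ ω, (J ω) ^ 4 ∂P = 3) ∧ (∫ ω, (J ω) ^ 5 ∂P = 0) ∧
      (∫ ω, (J ω) ^ 6 ∂P = 15) ∧ (∫ ω, (J ω) ^ 7 ∂P = 0) := by
  have hsqrt : Real.sqrt 6 ^ 2 = 6 := Real.sq_sqrt (by norm_num)
  have hlt : 1 < Real.sqrt 6 := by rw [Real.lt_sqrt] <;> norm_num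
  have expand : ∀ g : ℝ → ℝ,
      ∑ x ∈ {Real.sqrt 6, -Real.sqrt 6, 1, -1, 0}, P.real (J ⁻¹' {x}) * g x =
        1 / 30 * g (Real.sqrt 6) + 1 / 30 * g (-Real.sqrt 6) + 3 / 10 * g 1 +
          3 / 10 * g (-1) + 1 / 3 * g 0 := by
    intro g
    have hpre : ∀ x, J ⁻¹' {x} = {ω | J ω = x} := fun _ => rfl
    rw [Finset.sum_insert, Finset.sum_insert, Finset.sum_insert, Finset.sum_insert,
      Finset.sum_singleton]
    · simp only [hpre, measureReal_def, h1, h2, h3, h4, h5, ENNReal.toReal_div,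
        ENNReal.toReal_one, ENNReal.toReal_ofNat]
      ring
    all_goals
      simp only [Finset.mem_insert, Finset.mem_singleton, not_or]
      grind
  have key : ∀ n : ℕ, ∫ ω, J ω ^ n ∂P =
      1 / 30 * Real.sqrt 6 ^ n + 1 / 30 * (-Real.sqrt 6) ^ n + 3 / 10 * 1 ^ n +
        3 / 10 * (-1) ^ n + 1 / 3 * 0 ^ n := by
    intro n
    rw [← expand (· ^ n)]
    refine integral_comp_eq_sum_of_sum_measureReal_eq_one hJ ?_ (measurable_id.pow_const n)
    have h := expand fun _ => 1
    norm_num at h ⊢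
    exact h
  have hsqrt4 : Real.sqrt 6 ^ 4 = 36 := by rw [pow_mul _ 2 2, hsqrt]; norm_num
  have hsqrt6 : Real.sqrt 6 ^ 6 = 216 := by rw [pow_mul _ 2 3, hsqrt]; norm_num
  refine ⟨?_, ?_, ?_, ?_, ?_, ?_, ?_⟩
  · simpa using key 1
  · rw [key, neg_pow, hsqrt]; norm_num
  · rw [key]; ring
  · rw [key, neg_pow, hsqrt4]; norm_num
  · rw [key]; ring
  · rw [key, neg_pow, hsqrt6]; norm_num
  · rw [key]; ring
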